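/- The complement (within (ℕ_{>0})^d) of a skolemian set is semiskolemian. -/

import Mathlib

/-- Componentwise `p`-adic valuation of a vector `w ∈ ℕ^d`. -/
def vp {d : ℕ} (p : ℕ) (w : Fin d → ℕ) : Fin d → ℕ := fun t => padicValNat p (w t)

/-- The skolemian set `Def(α₁, …; α)` determined by a family of exceptional
semilinear sets `αs` (indexed by `ι`) and a default set `α`: the set of vectors
`w ∈ (ℕ_{>0})^d` such that there are pairwise distinct primes `p i` with
`vp (p i) w ∈ αs i`, and `vp q w ∈ α` for every other prime `q` with
`vp q w ≠ 0`. -/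
def SkolemDef {d : ℕ} {ι : Type} (αs : ι → Set (Fin d → ℕ)) (α : Set (Fin d → ℕ)) :
    Set (Fin d → ℕ) :=
  {w | (∀ t, 0 < w t) ∧ ∃ p : ι → ℕ,
    (∀ i, (p i).Prime) ∧ Function.Injective p ∧
    (∀ i, vp (p i) w ∈ αs i) ∧
    ∀ q : ℕ, q.Prime → (∀ i, p i ≠ q) → vp q w ≠ 0 → vp q w ∈ α}

/-- A linear subset of `ℕ^d`: a base vector plus arbitrary `ℕ`-combinations of
finitely many period vectors. -/
def IsLinear {d : ℕ} (A : Set (Fin d → ℕ)) : Prop :=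
  ∃ (b : Fin d → ℕ) (k : ℕ) (per : Fin k → Fin d → ℕ),
    A = {v | ∃ c : Fin k → ℕ, v = b + ∑ j, c j • per j}

/-- A semilinear subset of `ℕ^d`: a finite union of linear sets. -/
def IsSemilinear {d : ℕ} (A : Set (Fin d → ℕ)) : Prop :=
  ∃ (m : ℕ) (L : Fin m → Set (Fin d → ℕ)), (∀ i, IsLinear (L i)) ∧ A = ⋃ i, L i

/-- A skolemian subset of `(ℕ_{>0})^d`. -/
def IsSkolemian {d : ℕ} (S : Set (Fin d → ℕ)) : Prop :=
  ∃ (n : ℕ) (αs : Fin n → Set (Fin d → ℕ)) (α : Set (Fin d → ℕ)),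
    (∀ i, IsSemilinear (αs i)) ∧ IsSemilinear α ∧ (0 : Fin d → ℕ) ∈ α ∧
    (∀ i, (0 : Fin d → ℕ) ∉ αs i) ∧ S = SkolemDef αs α

/-- A semiskolemian set: a finite union of skolemian sets. -/
def IsSemiskolemian {d : ℕ} (S : Set (Fin d → ℕ)) : Prop :=
  ∃ (m : ℕ) (T : Fin m → Set (Fin d → ℕ)), (∀ i, IsSkolemian (T i)) ∧ S = ⋃ i, T i

/-- `M` is a matching in the bipartite graph with edge set `E ⊆ L × R`:
a set of pairwise non-adjacent edges. -/
def IsBipMatching {L R : Type*} (E M : Set (L × R)) : Prop :=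
  M ⊆ E ∧ ∀ e ∈ M, ∀ f ∈ M, e ≠ f → e.1 ≠ f.1 ∧ e.2 ≠ f.2

/-- `M` covers every left vertex in `L'`. -/
def CoversL {L R : Type*} (M : Set (L × R)) (L' : Set L) : Prop :=
  ∀ l ∈ L', ∃ e ∈ M, e.1 = l

/-- `M` covers every right vertex in `R'`. -/
def CoversR {L R : Type*} (M : Set (L × R)) (R' : Set R) : Prop :=
  ∀ r ∈ R', ∃ e ∈ M, e.2 = r


open Classical in
/-- Primes at which `w` has nonzero valuation vector of type `τ`. -/
noncomputable def cls {d : ℕ} {T : Type} (ty : (Fin d → ℕ) → T) (w : Fin d → ℕ) (τ : T) :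
    Finset ℕ :=
  (Finset.univ.biUnion fun t => (w t).primeFactors).filter (fun q => ty (vp q w) = τ)

theorem mem_cls {d : ℕ} {T : Type} (ty : (Fin d → ℕ) → T) {w : Fin d → ℕ} (hw : ∀ t, 0 < w t)
    (τ : T) (q : ℕ) : q ∈ cls ty w τ ↔ q.Prime ∧ vp q w ≠ 0 ∧ ty (vp q w) = τ := by
  classical
  unfold cls
  simp only [Finset.mem_filter, Finset.mem_biUnion, Finset.mem_univ, true_and,
    Nat.mem_primeFactors, ← and_assoc]
  refine and_congr_left fun _ => ?_
  constructor
  · rintro ⟨t, ⟨hq, hdvd⟩, h0⟩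
    refine ⟨hq, fun h => ?_⟩
    have h1 : padicValNat q (w t) = 0 := congrFun h t
    haveI := Fact.mk hq
    have := one_le_padicValNat_of_dvd h0 hdvd
    omega
  · rintro ⟨hq, h⟩
    obtain ⟨t, ht⟩ := Function.ne_iff.mp h
    refine ⟨t, ⟨hq, ?_⟩, (hw t).ne'⟩
    exact dvd_of_one_le_padicValNat (Nat.one_le_iff_ne_zero.mpr ht)

open Classical in
theorem assemble {ι T : Type} [Fintype ι] (g : ι → T) (P : T → Finset ℕ)
    (hP : ∀ σ τ q, q ∈ P σ → q ∈ P τ → σ = τ)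
    (hc : ∀ τ, (Finset.univ.filter (fun i => g i = τ)).card ≤ (P τ).card) :
    ∃ p : ι → ℕ, Function.Injective p ∧ (∀ i, p i ∈ P (g i)) ∧
      ∀ τ, (P τ).card ≤ (Finset.univ.filter (fun i => g i = τ)).card →
        ∀ q ∈ P τ, ∃ i, p i = q := by
  have key : ∀ τ, ∃ e : ι → ℕ, Set.MapsTo e (Finset.univ.filter (fun i => g i = τ)) (P τ) ∧
      Set.InjOn e (Finset.univ.filter (fun i => g i = τ)) := by
    intro τ
    obtain ⟨e, h1, h2⟩ := Set.Finite.exists_injOn_of_encard_le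
      (s := ((Finset.univ.filter (fun i => g i = τ) : Finset ι) : Set ι))
      (t := ((P τ : Finset ℕ) : Set ℕ)) (Finset.finite_toSet _)
      (by simpa only [Set.encard_coe_eq_coe_finsetCard, Nat.cast_le] using hc τ)
    exact ⟨e, h1, h2⟩
  choose e he1 he2 using key
  have hm : ∀ i, e (g i) i ∈ P (g i) := fun i => he1 (g i) (by simp)
  refine ⟨fun i => e (g i) i, ?_, hm, ?_⟩
  · intro i j hij
    simp only at hij
    have hg : g i = g j := hP _ _ _ (hm i) (hij ▸ hm j)
    rw [hg] at hij
    exact he2 (g j) (by simp [hg]) (by simp) hij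
  · intro τ hτ q hq
    obtain ⟨i, hi, rfl⟩ := Finset.surjOn_of_injOn_of_card_le (e τ) (he1 τ) (he2 τ) hτ hq
    refine ⟨i, ?_⟩
    have : g i = τ := by simpa using hi
    simp [this]

/-! ### Semilinear sets: comparison with Mathlib -/

theorem isLinear_iff {d : ℕ} (A : Set (Fin d → ℕ)) : IsLinear A ↔ IsLinearSet A := by
  constructor
  · rintro ⟨b, k, per, rfl⟩
    refine ⟨b, Set.range per, Set.finite_range _, ?_⟩
    ext v
    simp only [Set.mem_setOf_eq, Set.mem_vadd_set, SetLike.mem_coe,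
      AddSubmonoid.mem_closure_range_iff, vadd_eq_add]
    constructor
    · rintro ⟨c, rfl⟩
      refine ⟨_, ⟨Finsupp.equivFunOnFinite.symm c, rfl⟩, ?_⟩
      simp [Finsupp.sum_fintype]
    · rintro ⟨_, ⟨c, rfl⟩, rfl⟩
      refine ⟨c, ?_⟩
      simp [Finsupp.sum_fintype]
  · rintro ⟨b, t, ht, rfl⟩
    obtain ⟨k, per, hper⟩ := ht.fin_param
    obtain ⟨-, rfl⟩ := hper
    refine ⟨b, k, per, ?_⟩
    ext v
    simp only [Set.mem_setOf_eq, Set.mem_vadd_set, SetLike.mem_coe,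
      AddSubmonoid.mem_closure_range_iff, vadd_eq_add]
    constructor
    · rintro ⟨_, ⟨c, rfl⟩, rfl⟩
      refine ⟨c, ?_⟩
      simp [Finsupp.sum_fintype]
    · rintro ⟨c, rfl⟩
      refine ⟨_, ⟨Finsupp.equivFunOnFinite.symm c, rfl⟩, ?_⟩
      simp [Finsupp.sum_fintype]

theorem isSemilinear_iff {d : ℕ} (A : Set (Fin d → ℕ)) : IsSemilinear A ↔ IsSemilinearSet A := by
  constructor
  · rintro ⟨m, L, hL, rfl⟩
    exact IsSemilinearSet.iUnion fun i => ((isLinear_iff _).1 (hL i)).isSemilinearSet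
  · rintro ⟨S, hS, hL, rfl⟩
    obtain ⟨k, L, -, rfl⟩ := hS.fin_param
    refine ⟨k, L, fun i => (isLinear_iff _).2 (hL _ ⟨i, rfl⟩), by simp⟩

/-! ### Reindexing -/

theorem isSkolemian_of_fintype {d : ℕ} {ι : Type} [Fintype ι] (αs : ι → Set (Fin d → ℕ))
    (α : Set (Fin d → ℕ)) (h1 : ∀ i, IsSemilinear (αs i)) (h2 : IsSemilinear α)
    (h3 : (0 : Fin d → ℕ) ∈ α) (h4 : ∀ i, (0 : Fin d → ℕ) ∉ αs i) :
    IsSkolemian (SkolemDef αs α) := by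
  let e := Fintype.equivFin ι
  refine ⟨Fintype.card ι, αs ∘ e.symm, α, fun i => h1 _, h2, h3, fun i => h4 _, ?_⟩
  ext w
  refine and_congr_right fun _ => ?_
  constructor
  · rintro ⟨p, a, b, c, f⟩
    refine ⟨p ∘ e.symm, fun i => a _, b.comp e.symm.injective, fun i => c _, fun q hq h => ?_⟩
    exact f q hq fun i => by simpa using h (e i)
  · rintro ⟨p, a, b, c, f⟩
    refine ⟨p ∘ e, fun i => a _, b.comp e.injective, fun i => by simpa using c (e i),
      fun q hq h => ?_⟩
    exact f q hq fun i => by simpa using h (e.symm i)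

theorem isSemiskolemian_iUnion {d : ℕ} {ι : Type} [Finite ι] (S : ι → Set (Fin d → ℕ))
    (h : ∀ i, IsSkolemian (S i)) : IsSemiskolemian (⋃ i, S i) := by
  obtain ⟨n, ⟨e⟩⟩ := Finite.exists_equiv_fin ι
  refine ⟨n, S ∘ e.symm, fun i => h _, ?_⟩
  exact (e.symm.surjective.iUnion_comp S).symm

/-! ### Profiles -/

/-- Vectors whose type counts, truncated at `N`, are given by `f`. -/
def Prof {d : ℕ} {T : Type} (ty : (Fin d → ℕ) → T) (N : ℕ) (f : T → ℕ) : Set (Fin d → ℕ) :=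
  {w | (∀ t, 0 < w t) ∧ ∀ τ, min (cls ty w τ).card N = f τ}

theorem card_fiber_sigma {T : Type} [Fintype T] (f : T → ℕ) [DecidableEq T] (τ : T) :
    (Finset.univ.filter (fun x : (Σ τ, Fin (f τ)) => x.1 = τ)).card = f τ := by
  have : Finset.univ.filter (fun x : (Σ τ, Fin (f τ)) => x.1 = τ) =
      Finset.univ.map (Function.Embedding.sigmaMk (β := fun τ => Fin (f τ)) τ) := by
    ext ⟨σ, k⟩
    simp only [Finset.mem_filter, Finset.mem_univ, true_and, Finset.mem_map]
    constructor
    · rintro rfl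
      exact ⟨k, rfl⟩
    · rintro ⟨a, ha⟩
      exact (congrArg Sigma.fst ha).symm
  rw [this]
  simp

theorem prof_eq {d : ℕ} {T : Type} [Fintype T] (ty : (Fin d → ℕ) → T) (N : ℕ) (f : T → ℕ)
    (hf : ∀ τ, f τ ≤ N) :
    Prof ty N f = SkolemDef (ι := Σ τ, Fin (f τ)) (fun x => {v | v ≠ 0 ∧ ty v = x.1})
      {v | v = 0 ∨ f (ty v) = N} := by
  classical
  ext w
  refine and_congr_right fun hw => ?_
  constructor
  · intro h
    have hle : ∀ τ, f τ ≤ (cls ty w τ).card := fun τ => by rw [← h τ]; exact min_le_left _ _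
    obtain ⟨p, hinj, hp, hs⟩ := assemble (ι := Σ τ, Fin (f τ)) Sigma.fst (cls ty w)
      (fun σ τ q h1 h2 => by
        rw [mem_cls ty hw] at h1 h2
        exact h1.2.2.symm.trans h2.2.2)
      (fun τ => by convert hle τ; exact card_fiber_sigma f τ)
    simp only [mem_cls ty hw] at hp
    refine ⟨p, fun i => (hp i).1, hinj, fun i => (hp i).2, fun q hq hne h0 => ?_⟩
    right
    by_contra hN
    have h1 := h (ty (vp q w))
    have h2 := hf (ty (vp q w))
    obtain ⟨i, hi⟩ := hs (ty (vp q w)) (by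
      have h3 := card_fiber_sigma f (ty (vp q w))
      have h4 : (cls ty w (ty (vp q w))).card ≤ f (ty (vp q w)) := by omega
      convert h4) q ((mem_cls ty hw _ _).2 ⟨hq, h0, rfl⟩)
    exact hne i hi
  · rintro ⟨p, hpr, hinj, hp, hd⟩ τ
    have h1 : f τ ≤ (cls ty w τ).card := by
      have := Finset.card_le_card_of_injOn (s := (Finset.univ : Finset (Fin (f τ))))
        (t := cls ty w τ) (fun k => p ⟨τ, k⟩)
        (fun k _ => (mem_cls ty hw _ _).2 ⟨hpr _, hp ⟨τ, k⟩⟩)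
        (fun a _ b _ hab => by simpa using hinj hab)
      simpa using this
    have h2 := hf τ
    by_cases hN : f τ = N
    · omega
    · have h3 : (cls ty w τ).card ≤ f τ := by
        have := Finset.card_le_card_of_surjOn (s := (Finset.univ : Finset (Fin (f τ))))
          (t := cls ty w τ) (fun k => p ⟨τ, k⟩) (by
            intro q hq
            obtain ⟨hq1, hq2, hq3⟩ := (mem_cls ty hw _ _).1 hq
            by_contra hno
            rcases hd q hq1 (by
              rintro ⟨σ, k⟩ rfl
              have : ty (vp (p ⟨σ, k⟩) w) = σ := (hp ⟨σ, k⟩).2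
              rw [this] at hq3
              subst hq3
              exact hno ⟨k, by simp, rfl⟩) hq2 with h | h
            · exact hq2 h
            · rw [hq3] at h
              exact hN h)
        simpa using this
      omega

/-- The type of a vector: which of the data sets it belongs to. -/
def typ {d n : ℕ} (αs : Fin n → Set (Fin d → ℕ)) (α : Set (Fin d → ℕ)) (v : Fin d → ℕ) :
    Option (Fin n) → Prop
  | none => v ∈ α
  | some i => v ∈ αs i

/-- Membership depends only on the truncated profile. -/
theorem skolem_invariant {d n : ℕ} (αs : Fin n → Set (Fin d → ℕ)) (α : Set (Fin d → ℕ))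
    (h0 : ∀ i, (0 : Fin d → ℕ) ∉ αs i) (f : (Option (Fin n) → Prop) → ℕ) (w w' : Fin d → ℕ)
    (hw : w ∈ Prof (typ αs α) (n + 1) f) (hw' : w' ∈ Prof (typ αs α) (n + 1) f)
    (hS : w ∈ SkolemDef αs α) : w' ∈ SkolemDef αs α := by
  classical
  obtain ⟨hpos, p, hpr, hinj, hp, hd⟩ := hS
  have hpos' := hw'.1
  set ty := typ αs α with hty
  set g : Fin n → (Option (Fin n) → Prop) := fun i => ty (vp (p i) w) with hg
  have hmin : ∀ τ, min (cls ty w τ).card (n + 1) = min (cls ty w' τ).card (n + 1) :=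
    fun τ => (hw.2 τ).trans (hw'.2 τ).symm
  have hn : ∀ τ, (Finset.univ.filter (fun i => g i = τ)).card ≤ n := fun τ =>
    (Finset.card_le_univ _).trans (by simp)
  have hle : ∀ τ, (Finset.univ.filter (fun i => g i = τ)).card ≤ (cls ty w τ).card := by
    intro τ
    refine Finset.card_le_card_of_injOn p (fun i hi => ?_) hinj.injOn
    have hi' : g i = τ := by simpa using hi
    exact (mem_cls ty hpos _ _).2 ⟨hpr i, fun h => h0 i (h ▸ hp i), hi'⟩
  obtain ⟨p', hinj', hp', hs'⟩ := assemble g (cls ty w')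
      (fun σ τ q h1 h2 => by
        rw [mem_cls ty hpos'] at h1 h2
        exact h1.2.2.symm.trans h2.2.2)
      (fun τ => by
        have := hmin τ
        have := hn τ
        have := hle τ
        have h5 : (Finset.univ.filter (fun i => g i = τ)).card ≤ (cls ty w' τ).card := by omega
        convert h5)
  simp only [mem_cls ty hpos'] at hp'
  refine ⟨hpos', p', fun i => (hp' i).1, hinj', fun i => ?_, fun q hq hne hq0 => ?_⟩
  · have h1 : ty (vp (p' i) w') (some i) = ty (vp (p i) w) (some i) :=
      congrFun (hp' i).2.2 (some i)
    have h2 : (vp (p' i) w' ∈ αs i) = (vp (p i) w ∈ αs i) := h1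
    rw [h2]
    exact hp i
  · by_contra hα
    set τ := ty (vp q w') with hτ
    have hb : (cls ty w τ).card ≤ (Finset.univ.filter (fun i => g i = τ)).card := by
      refine Finset.card_le_card_of_surjOn p ?_
      intro r hr
      obtain ⟨hr1, hr2, hr3⟩ := (mem_cls ty hpos _ _).1 hr
      have hr4 : vp r w ∉ α := by
        have h1 : (vp r w ∈ α) = (vp q w' ∈ α) := congrFun hr3 none
        rw [h1]
        exact hα
      by_contra hno
      refine hr4 (hd r hr1 (fun i hi => hno ⟨i, ?_, hi⟩) hr2)
      subst hi
      simpa using hr3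
    obtain ⟨i, hi⟩ := hs' τ (by
      have := hmin τ
      have := hn τ
      have h5 : (cls ty w' τ).card ≤ (Finset.univ.filter (fun i => g i = τ)).card := by omega
      convert h5) q ((mem_cls ty hpos' _ _).2 ⟨hq, hq0, rfl⟩)
    exact hne i hi

theorem isSemilinearSet_typ {d n : ℕ} (αs : Fin n → Set (Fin d → ℕ)) (α : Set (Fin d → ℕ))
    (h1 : ∀ i, IsSemilinearSet (αs i)) (h2 : IsSemilinearSet α) (τ : Option (Fin n) → Prop) :
    IsSemilinearSet {v | typ αs α v = τ} := by
  have aux : ∀ (A : Set (Fin d → ℕ)) (P : Prop), IsSemilinearSet A →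
      IsSemilinearSet {v | (v ∈ A) = P} := by
    intro A P hA
    by_cases hP : P
    · simpa [hP] using hA
    · simpa [hP] using! hA.compl
  have : {v | typ αs α v = τ} = ⋂ o, {v | typ αs α v o = τ o} := by
    ext v
    simp [funext_iff]
  rw [this]
  refine IsSemilinearSet.iInter fun o => ?_
  cases o with
  | none => exact aux _ _ h2
  | some i => exact aux _ _ (h1 i)

theorem isSkolemian_prof {d n : ℕ} (αs : Fin n → Set (Fin d → ℕ)) (α : Set (Fin d → ℕ))
    (h1 : ∀ i, IsSemilinearSet (αs i)) (h2 : IsSemilinearSet α) (N : ℕ)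
    (f : (Option (Fin n) → Prop) → ℕ) (hf : ∀ τ, f τ ≤ N) :
    IsSkolemian (Prof (typ αs α) N f) := by
  classical
  haveI : Fintype (Option (Fin n) → Prop) := Fintype.ofFinite _
  have ht := isSemilinearSet_typ αs α h1 h2
  rw [prof_eq _ _ _ hf]
  refine isSkolemian_of_fintype _ _ (fun x => ?_) ?_ (Or.inl rfl) (fun x hx => hx.1 rfl)
  · rw [isSemilinear_iff]
    exact (IsSemilinearSet.singleton (0 : Fin d → ℕ)).compl.inter (ht x.1)
  · rw [isSemilinear_iff]
    have : {v | v = 0 ∨ f (typ αs α v) = N} =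
        {0} ∪ ⋃ τ : {τ // f τ = N}, {v | typ αs α v = τ.1} := by
      ext v
      simp
    rw [this]
    exact (IsSemilinearSet.singleton _).union (.iUnion fun τ => ht τ.1)

/-- The complement, within `(ℕ_{>0})^d`, of a skolemian set is semiskolemian. -/
theorem skolemian_compl {d : ℕ} (S : Set (Fin d → ℕ)) (hS : IsSkolemian S) :
    IsSemiskolemian ({w : Fin d → ℕ | ∀ t, 0 < w t} \ S) := by
  classical
  obtain ⟨n, αs, α, h1, h2, -, h4, rfl⟩ := hS
  simp only [isSemilinear_iff] at h1 h2
  let F : ((Option (Fin n) → Prop) → Fin (n + 2)) → Set (Fin d → ℕ) :=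
    fun f => Prof (typ αs α) (n + 1) (fun τ => (f τ : ℕ))
  have : {w : Fin d → ℕ | ∀ t, 0 < w t} \ SkolemDef αs α =
      ⋃ f : {f // Disjoint (F f) (SkolemDef αs α)}, F f.1 := by
    ext w
    simp only [Set.mem_iUnion]
    constructor
    · rintro ⟨hw, hS⟩
      let f : (Option (Fin n) → Prop) → Fin (n + 2) :=
        fun τ => ⟨min (cls (typ αs α) w τ).card (n + 1), by omega⟩
      have hwf : w ∈ F f := ⟨hw, fun τ => rfl⟩
      refine ⟨⟨f, Set.disjoint_left.2 fun v hv hvS => hS ?_⟩, hwf⟩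
      exact skolem_invariant αs α h4 _ v w hv hwf hvS
    · rintro ⟨⟨f, hf⟩, hwf⟩
      exact ⟨hwf.1, Set.disjoint_left.1 hf hwf⟩
  rw [this]
  exact isSemiskolemian_iUnion _ fun f =>
    isSkolemian_prof αs α h1 h2 _ _ fun τ => Nat.lt_succ_iff.1 (f.1 τ).isLt
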